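/- arXiv:2309.09234 — 4 statements merged into one kernel-verified Lean document; each statement's English description precedes it below -/
import Mathlib

section
/- Let q belong to the Schwartz space 𝒮(ℝ;ℂ) and let λ ∈ ℂ satisfy Im(λ²) ≥ 0. Then ( I_λ({x₁<y₁}) )² = 2·I_λ({x₁<y₁<x₂<y₂}) + 4·I_λ({x₁<x₂<y₁<y₂}), where each region is a subset of ℝ² or ℝ⁴ cut out by the indicated chain of strict inequalities; all three integrals converge absolutely. -/
open MeasureTheory

/-- The elementary kernel `q(y)·conj(q(x))·exp(2iλ²(y−x))`. -/
noncomputable def ker (q : ℝ → ℂ) (lam : ℂ) (x y : ℝ) : ℂ :=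
  q y * (starRingEnd ℂ) (q x) * Complex.exp (2 * Complex.I * lam ^ 2 * ((y - x : ℝ) : ℂ))

/-- Integrand on `ℝ²`, in the variables `p = (x₁, y₁)`. -/
noncomputable def f2 (q : ℝ → ℂ) (lam : ℂ) (p : ℝ × ℝ) : ℂ :=
  ker q lam p.1 p.2

/-- Integrand on `ℝ⁴`, in the variables `p = (x₁, y₁, x₂, y₂)`. -/
noncomputable def f4 (q : ℝ → ℂ) (lam : ℂ) (p : ℝ × ℝ × ℝ × ℝ) : ℂ :=
  ker q lam p.1 p.2.1 * ker q lam p.2.2.1 p.2.2.2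

/-- Integrand on `ℝ⁶`, in the variables `p = (x₁, y₁, x₂, y₂, x₃, y₃)`. -/
noncomputable def f6 (q : ℝ → ℂ) (lam : ℂ) (p : ℝ × ℝ × ℝ × ℝ × ℝ × ℝ) : ℂ :=
  ker q lam p.1 p.2.1 * ker q lam p.2.2.1 p.2.2.2.1 * ker q lam p.2.2.2.2.1 p.2.2.2.2.2

/-- The region `{x₁ < y₁}` of `ℝ²`, in the variables `p = (x₁, y₁)`. -/
def R_XY : Set (ℝ × ℝ) := {p | p.1 < p.2}

/-- The region `{x₁ < y₁ < x₂ < y₂}` of `ℝ⁴`, in the variables `p = (x₁, y₁, x₂, y₂)`. -/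
def R_XYXY : Set (ℝ × ℝ × ℝ × ℝ) :=
  {p | p.1 < p.2.1 ∧ p.2.1 < p.2.2.1 ∧ p.2.2.1 < p.2.2.2}

/-- The region `{x₁ < x₂ < y₁ < y₂}` of `ℝ⁴`, in the variables `p = (x₁, y₁, x₂, y₂)`. -/
def R_XXYY : Set (ℝ × ℝ × ℝ × ℝ) :=
  {p | p.1 < p.2.2.1 ∧ p.2.2.1 < p.2.1 ∧ p.2.1 < p.2.2.2}

/-- The region `{x₁ < y₁ < x₂ < y₂ < x₃ < y₃}` of `ℝ⁶`,
in the variables `p = (x₁, y₁, x₂, y₂, x₃, y₃)`. -/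
def R_XYXYXY : Set (ℝ × ℝ × ℝ × ℝ × ℝ × ℝ) :=
  {p | p.1 < p.2.1 ∧ p.2.1 < p.2.2.1 ∧ p.2.2.1 < p.2.2.2.1 ∧
       p.2.2.2.1 < p.2.2.2.2.1 ∧ p.2.2.2.2.1 < p.2.2.2.2.2}

/-- The region `{x₁ < x₂ < y₁ < y₂ < x₃ < y₃}` of `ℝ⁶`,
in the variables `p = (x₁, y₁, x₂, y₂, x₃, y₃)`. -/
def R_XXYYXY : Set (ℝ × ℝ × ℝ × ℝ × ℝ × ℝ) :=
  {p | p.1 < p.2.2.1 ∧ p.2.2.1 < p.2.1 ∧ p.2.1 < p.2.2.2.1 ∧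
       p.2.2.2.1 < p.2.2.2.2.1 ∧ p.2.2.2.2.1 < p.2.2.2.2.2}

/-- The region `{x₁ < x₂ < y₁ < x₃ < y₂ < y₃}` of `ℝ⁶`,
in the variables `p = (x₁, y₁, x₂, y₂, x₃, y₃)`. -/
def R_XXYXYY : Set (ℝ × ℝ × ℝ × ℝ × ℝ × ℝ) :=
  {p | p.1 < p.2.2.1 ∧ p.2.2.1 < p.2.1 ∧ p.2.1 < p.2.2.2.2.1 ∧
       p.2.2.2.2.1 < p.2.2.2.1 ∧ p.2.2.2.1 < p.2.2.2.2.2}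

/-- The region `{x₁ < y₁ < x₂ < x₃ < y₂ < y₃}` of `ℝ⁶`,
in the variables `p = (x₁, y₁, x₂, y₂, x₃, y₃)`. -/
def R_XYXXYY : Set (ℝ × ℝ × ℝ × ℝ × ℝ × ℝ) :=
  {p | p.1 < p.2.1 ∧ p.2.1 < p.2.2.1 ∧ p.2.2.1 < p.2.2.2.2.1 ∧
       p.2.2.2.2.1 < p.2.2.2.1 ∧ p.2.2.2.1 < p.2.2.2.2.2}

/-- The region `{x₁ < x₂ < x₃ < y₁ < y₂ < y₃}` of `ℝ⁶`,
in the variables `p = (x₁, y₁, x₂, y₂, x₃, y₃)`. -/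
def R_XXXYYY : Set (ℝ × ℝ × ℝ × ℝ × ℝ × ℝ) :=
  {p | p.1 < p.2.2.1 ∧ p.2.2.1 < p.2.2.2.2.1 ∧ p.2.2.2.2.1 < p.2.1 ∧
       p.2.1 < p.2.2.2.1 ∧ p.2.2.2.1 < p.2.2.2.2.2}

/-- The measurable equivalence `(x₁, y₁, x₂, y₂) ↦ (x₂, y₂, x₁, y₁)`. -/
noncomputable def swapPairs : (ℝ × ℝ × ℝ × ℝ) ≃ᵐ (ℝ × ℝ × ℝ × ℝ) :=
  MeasurableEquiv.prodAssoc.symm.trans (MeasurableEquiv.prodComm.trans MeasurableEquiv.prodAssoc)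

/-- The measurable equivalence `(a, b, c) ↦ (c, b, a)`. -/
noncomputable def reverseTriple : (ℝ × ℝ × ℝ) ≃ᵐ (ℝ × ℝ × ℝ) :=
  MeasurableEquiv.prodComm.trans
    (((MeasurableEquiv.prodComm).prodCongr (MeasurableEquiv.refl ℝ)).trans
      MeasurableEquiv.prodAssoc)

/-- The measurable equivalence `(x₁, y₁, x₂, y₂) ↦ (x₁, y₂, x₂, y₁)`. -/
noncomputable def swapSnds : (ℝ × ℝ × ℝ × ℝ) ≃ᵐ (ℝ × ℝ × ℝ × ℝ) :=
  (MeasurableEquiv.refl ℝ).prodCongr reverseTriple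

lemma swapPairs_apply (p : ℝ × ℝ × ℝ × ℝ) :
    swapPairs p = (p.2.2.1, p.2.2.2, p.1, p.2.1) := rfl

lemma swapSnds_apply (p : ℝ × ℝ × ℝ × ℝ) :
    swapSnds p = (p.1, p.2.2.2, p.2.2.1, p.2.1) := rfl

lemma measurePreserving_swapPairs : MeasurePreserving swapPairs :=
  (volume_preserving_prodAssoc (α₁ := ℝ) (β₁ := ℝ) (γ₁ := ℝ × ℝ)).comp
    ((Measure.measurePreserving_swap (μ := (volume : Measure (ℝ × ℝ)))
      (ν := (volume : Measure (ℝ × ℝ)))).comp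
      (volume_preserving_prodAssoc (α₁ := ℝ) (β₁ := ℝ) (γ₁ := ℝ × ℝ)).symm)

lemma measurePreserving_reverseTriple : MeasurePreserving reverseTriple :=
  (volume_preserving_prodAssoc (α₁ := ℝ) (β₁ := ℝ) (γ₁ := ℝ)).comp
    (((Measure.measurePreserving_swap (μ := (volume : Measure ℝ))
      (ν := (volume : Measure ℝ))).prod (MeasurePreserving.id volume)).comp
      (Measure.measurePreserving_swap (μ := (volume : Measure ℝ))
        (ν := (volume : Measure (ℝ × ℝ)))))

lemma measurePreserving_swapSnds : MeasurePreserving swapSnds :=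
  (MeasurePreserving.id volume).prod measurePreserving_reverseTriple

lemma f4_swapPairs (q : ℝ → ℂ) (lam : ℂ) (p : ℝ × ℝ × ℝ × ℝ) :
    f4 q lam (swapPairs p) = f4 q lam p :=
  mul_comm _ _

lemma ker_mul_ker_swap (q : ℝ → ℂ) (lam : ℂ) (x₁ y₁ x₂ y₂ : ℝ) :
    ker q lam x₁ y₂ * ker q lam x₂ y₁ = ker q lam x₁ y₁ * ker q lam x₂ y₂ := by
  have h : Complex.exp (2 * Complex.I * lam ^ 2 * ((y₂ - x₁ : ℝ) : ℂ)) *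
      Complex.exp (2 * Complex.I * lam ^ 2 * ((y₁ - x₂ : ℝ) : ℂ)) =
      Complex.exp (2 * Complex.I * lam ^ 2 * ((y₁ - x₁ : ℝ) : ℂ)) *
      Complex.exp (2 * Complex.I * lam ^ 2 * ((y₂ - x₂ : ℝ) : ℂ)) := by
    rw [← Complex.exp_add, ← Complex.exp_add]
    congr 1
    push_cast
    ring
  unfold ker
  linear_combination
    q y₁ * q y₂ * (starRingEnd ℂ) (q x₁) * (starRingEnd ℂ) (q x₂) * h

lemma f4_swapSnds (q : ℝ → ℂ) (lam : ℂ) (p : ℝ × ℝ × ℝ × ℝ) :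
    f4 q lam (swapSnds p) = f4 q lam p :=
  ker_mul_ker_swap q lam p.1 p.2.1 p.2.2.1 p.2.2.2

lemma measurableSet_R_XY : MeasurableSet R_XY :=
  measurableSet_lt measurable_fst measurable_snd

lemma measurableSet_R_XYXY : MeasurableSet R_XYXY := by
  unfold R_XYXY
  measurability

lemma measurableSet_R_XXYY : MeasurableSet R_XXYY := by
  unfold R_XXYY
  measurability

lemma ae_linearMap_ne_zero {E : Type*} [NormedAddCommGroup E] [NormedSpace ℝ E]
    [MeasurableSpace E] [BorelSpace E] [FiniteDimensional ℝ E] (μ : Measure E)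
    [μ.IsAddHaarMeasure] (L : E →ₗ[ℝ] ℝ) (hL : L ≠ 0) : ∀ᵐ p ∂μ, L p ≠ 0 := by
  have h := Measure.addHaar_submodule μ (LinearMap.ker L) (by rwa [Ne, LinearMap.ker_eq_top])
  filter_upwards [measure_eq_zero_iff_ae_notMem.mp h] with p hp
  simpa using hp

lemma ae_coordinates_ne : ∀ᵐ p : ℝ × ℝ × ℝ × ℝ,
    p.1 ≠ p.2.2.1 ∧ p.2.1 ≠ p.2.2.2 ∧ p.1 ≠ p.2.2.2 ∧ p.2.2.1 ≠ p.2.1 := by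
  let X₁ : ℝ × ℝ × ℝ × ℝ →ₗ[ℝ] ℝ := LinearMap.fst ℝ _ _
  let Y₁ : ℝ × ℝ × ℝ × ℝ →ₗ[ℝ] ℝ := LinearMap.fst ℝ _ _ ∘ₗ LinearMap.snd ℝ _ _
  let X₂ : ℝ × ℝ × ℝ × ℝ →ₗ[ℝ] ℝ :=
    LinearMap.fst ℝ _ _ ∘ₗ LinearMap.snd ℝ _ _ ∘ₗ LinearMap.snd ℝ _ _
  let Y₂ : ℝ × ℝ × ℝ × ℝ →ₗ[ℝ] ℝ :=
    LinearMap.snd ℝ _ _ ∘ₗ LinearMap.snd ℝ _ _ ∘ₗ LinearMap.snd ℝ _ _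
  have key (L M : ℝ × ℝ × ℝ × ℝ →ₗ[ℝ] ℝ) (v : ℝ × ℝ × ℝ × ℝ) (hv : L v ≠ M v) :
      ∀ᵐ p : ℝ × ℝ × ℝ × ℝ, L p ≠ M p := by
    have hLM : L - M ≠ 0 := fun h => hv (by rw [sub_eq_zero.mp h])
    have : (volume : Measure (ℝ × ℝ × ℝ)).IsAddHaarMeasure :=
      Measure.prod.instIsAddHaarMeasure _ _
    have : (volume : Measure (ℝ × ℝ × ℝ × ℝ)).IsAddHaarMeasure :=
      Measure.prod.instIsAddHaarMeasure _ _
    filter_upwards [ae_linearMap_ne_zero volume (L - M) hLM] with p hp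
    exact sub_ne_zero.mp hp
  filter_upwards [key X₁ X₂ (1, 0, 0, 0) (by simp [X₁, X₂]),
    key Y₁ Y₂ (0, 1, 0, 0) (by simp [Y₁, Y₂]),
    key X₁ Y₂ (1, 0, 0, 0) (by simp [X₁, Y₂]),
    key X₂ Y₁ (0, 1, 0, 0) (by simp [X₂, Y₁])] with p h₁ h₂ h₃ h₄
  exact ⟨h₁, h₂, h₃, h₄⟩

/-- Two ordered pairs interleave in exactly one of six ways. -/
lemma shuffle_ite (w : ℂ) {x₁ y₁ x₂ y₂ : ℝ} (hx : x₁ ≠ x₂) (hy : y₁ ≠ y₂) (h₁ : x₁ ≠ y₂)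
    (h₂ : x₂ ≠ y₁) :
    (if x₁ < y₁ ∧ x₂ < y₂ then w else 0) =
      (if x₁ < y₁ ∧ y₁ < x₂ ∧ x₂ < y₂ then w else 0) +
      (if x₂ < y₂ ∧ y₂ < x₁ ∧ x₁ < y₁ then w else 0) +
      (if x₁ < x₂ ∧ x₂ < y₁ ∧ y₁ < y₂ then w else 0) +
      (if x₂ < x₁ ∧ x₁ < y₂ ∧ y₂ < y₁ then w else 0) +
      (if x₁ < x₂ ∧ x₂ < y₂ ∧ y₂ < y₁ then w else 0) +
      (if x₂ < x₁ ∧ x₁ < y₁ ∧ y₁ < y₂ then w else 0) := by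
  grind (splits := 20)

lemma norm_cexp_le_one_of_lt {lam : ℂ} (hlam : 0 ≤ (lam ^ 2).im) {x y : ℝ} (hxy : x < y) :
    ‖Complex.exp (2 * Complex.I * lam ^ 2 * ((y - x : ℝ) : ℂ))‖ ≤ 1 := by
  rw [Complex.norm_exp, Real.exp_le_one_iff, Complex.re_mul_ofReal]
  have h : (2 * Complex.I * lam ^ 2).re = -2 * (lam ^ 2).im := by
    simp [Complex.mul_re, Complex.mul_im]
  rw [h]
  nlinarith [mul_nonneg hlam (sub_pos.mpr hxy).le]

lemma integrableOn_f2 (q : SchwartzMap ℝ ℂ) (lam : ℂ) (hlam : 0 ≤ (lam ^ 2).im) :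
    IntegrableOn (f2 ⇑q lam) R_XY volume := by
  have hq : Integrable q := q.integrable
  have hbound : Integrable (fun p : ℝ × ℝ => ‖q p.1‖ * ‖q p.2‖) volume :=
    hq.norm.mul_prod hq.norm
  refine hbound.integrableOn.mono' (Continuous.aestronglyMeasurable ?_) ?_
  · have hc := q.continuous
    unfold f2 ker
    fun_prop
  · filter_upwards [ae_restrict_mem measurableSet_R_XY] with p hp
    have h := norm_cexp_le_one_of_lt hlam hp
    rw [f2, ker, norm_mul, norm_mul, RCLike.norm_conj, mul_comm ‖q p.2‖]
    exact mul_le_of_le_one_right (by positivity) h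

lemma integrable_prod_f2 (q : SchwartzMap ℝ ℂ) (lam : ℂ) (hlam : 0 ≤ (lam ^ 2).im) :
    Integrable (fun p : ℝ × ℝ × ℝ × ℝ =>
      R_XY.indicator (f2 q lam) (p.1, p.2.1) * R_XY.indicator (f2 q lam) p.2.2) := by
  have hG := (integrable_indicator_iff measurableSet_R_XY).mpr (integrableOn_f2 q lam hlam)
  exact (volume_preserving_prodAssoc (α₁ := ℝ) (β₁ := ℝ) (γ₁ := ℝ × ℝ)).symm.integrable_comp_emb
    MeasurableEquiv.prodAssoc.symm.measurableEmbedding |>.mpr (hG.mul_prod hG)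

lemma integral_prod_f2 (q : ℝ → ℂ) (lam : ℂ) :
    ∫ p : ℝ × ℝ × ℝ × ℝ,
      R_XY.indicator (f2 q lam) (p.1, p.2.1) * R_XY.indicator (f2 q lam) p.2.2 =
      (∫ p in R_XY, f2 q lam p) ^ 2 := by
  have h := (volume_preserving_prodAssoc (α₁ := ℝ) (β₁ := ℝ) (γ₁ := ℝ × ℝ)).symm.integral_comp'
    (fun z : (ℝ × ℝ) × (ℝ × ℝ) =>
      R_XY.indicator (f2 q lam) z.1 * R_XY.indicator (f2 q lam) z.2)
  refine h.trans ((integral_prod_mul _ _).trans ?_)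
  rw [integral_indicator measurableSet_R_XY, sq]

lemma prod_indicator_f2_eq (q : ℝ → ℂ) (lam : ℂ) (p : ℝ × ℝ × ℝ × ℝ) :
    R_XY.indicator (f2 q lam) (p.1, p.2.1) * R_XY.indicator (f2 q lam) p.2.2 =
      {p : ℝ × ℝ × ℝ × ℝ | p.1 < p.2.1 ∧ p.2.2.1 < p.2.2.2}.indicator (f4 q lam) p := by
  classical
  simp only [Set.indicator_apply, R_XY, Set.mem_ofPred_eq, f2, f4, ite_and]
  split_ifs <;> simp

lemma integrableOn_f4 (q : SchwartzMap ℝ ℂ) (lam : ℂ) (hlam : 0 ≤ (lam ^ 2).im) :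
    IntegrableOn (f4 q lam) {p | p.1 < p.2.1 ∧ p.2.2.1 < p.2.2.2} volume := by
  have hS : MeasurableSet {p : ℝ × ℝ × ℝ × ℝ | p.1 < p.2.1 ∧ p.2.2.1 < p.2.2.2} := by
    measurability
  rw [← integrable_indicator_iff hS]
  exact (integrable_prod_f2 q lam hlam).congr (.of_forall (prod_indicator_f2_eq q lam))

lemma prod_indicator_f2_ae_eq (q : ℝ → ℂ) (lam : ℂ) :
    (fun p : ℝ × ℝ × ℝ × ℝ =>
      R_XY.indicator (f2 q lam) (p.1, p.2.1) * R_XY.indicator (f2 q lam) p.2.2) =ᵐ[volume]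
    R_XYXY.indicator (f4 q lam) + R_XYXY.indicator (f4 q lam) ∘ swapPairs +
      R_XXYY.indicator (f4 q lam) + R_XXYY.indicator (f4 q lam) ∘ swapPairs +
      R_XXYY.indicator (f4 q lam) ∘ swapSnds +
      (R_XXYY.indicator (f4 q lam) ∘ swapSnds) ∘ swapPairs := by
  classical
  filter_upwards [ae_coordinates_ne] with p hp
  obtain ⟨hx, hy, h₁, h₂⟩ := hp
  rw [prod_indicator_f2_eq]
  have hA : f4 q lam (p.2.2.1, p.2.2.2, p.1, p.2.1) = f4 q lam p := f4_swapPairs q lam p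
  have hB : f4 q lam (p.1, p.2.2.2, p.2.2.1, p.2.1) = f4 q lam p := f4_swapSnds q lam p
  have hBA : f4 q lam (p.2.2.1, p.2.1, p.1, p.2.2.2) = f4 q lam p :=
    (f4_swapSnds q lam (swapPairs p)).trans hA
  simp only [Pi.add_apply, Function.comp_apply, Set.indicator_apply, R_XYXY, R_XXYY,
    Set.mem_ofPred_eq, swapPairs_apply, swapSnds_apply, hA, hB, hBA]
  exact shuffle_ite (f4 q lam p) hx hy h₁ h₂

/-- Fubini-type shuffle identity `(XY)² = 2·XYXY + 4·XXYY` for the iterated integrals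
`I_λ(Σ) = ∫_Σ ∏ q(y_k) conj(q(x_k)) e^{2iλ²(y_k−x_k)}`, for Schwartz `q` and `Im(λ²) ≥ 0`;
all three integrals converge absolutely. -/
theorem shuffle_XY_sq (q : SchwartzMap ℝ ℂ) (lam : ℂ) (hlam : 0 ≤ (lam ^ 2).im) :
    IntegrableOn (f2 ⇑q lam) R_XY volume ∧
    IntegrableOn (f4 ⇑q lam) R_XYXY volume ∧
    IntegrableOn (f4 ⇑q lam) R_XXYY volume ∧
    (∫ p in R_XY, f2 ⇑q lam p) ^ 2
      = 2 * (∫ p in R_XYXY, f4 ⇑q lam p) + 4 * (∫ p in R_XXYY, f4 ⇑q lam p) := by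
  have hXYXY : IntegrableOn (f4 q lam) R_XYXY volume :=
    (integrableOn_f4 q lam hlam).mono_set fun p hp => ⟨hp.1, hp.2.2⟩
  have hXXYY : IntegrableOn (f4 q lam) R_XXYY volume :=
    (integrableOn_f4 q lam hlam).mono_set fun p hp =>
      ⟨hp.1.trans hp.2.1, hp.2.1.trans hp.2.2⟩
  refine ⟨integrableOn_f2 q lam hlam, hXYXY, hXXYY, ?_⟩
  have hU := (integrable_indicator_iff measurableSet_R_XYXY).mpr hXYXY
  have hV := (integrable_indicator_iff measurableSet_R_XXYY).mpr hXXYY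
  have hA := measurePreserving_swapPairs
  have hB := measurePreserving_swapSnds
  have hUA := hA.integrable_comp_of_integrable hU
  have hVA := hA.integrable_comp_of_integrable hV
  have hVB := hB.integrable_comp_of_integrable hV
  have hVBA := hA.integrable_comp_of_integrable hVB
  rw [← integral_prod_f2, integral_congr_ae (prod_indicator_f2_ae_eq q lam),
    integral_add' ((((hU.add hUA).add hV).add hVA).add hVB) hVBA,
    integral_add' (((hU.add hUA).add hV).add hVA) hVB,
    integral_add' ((hU.add hUA).add hV) hVA, integral_add' (hU.add hUA) hV,
    integral_add' hU hUA]
  simp only [Function.comp_apply]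
  rw [hA.integral_comp' (R_XYXY.indicator (f4 q lam)),
    hA.integral_comp' (R_XXYY.indicator (f4 q lam)),
    hA.integral_comp' (fun p => R_XXYY.indicator (f4 q lam) (swapSnds p)),
    hB.integral_comp' (R_XXYY.indicator (f4 q lam)),
    integral_indicator measurableSet_R_XYXY, integral_indicator measurableSet_R_XXYY]
  ring
end

section
/- Let q belong to the Schwartz space 𝒮(ℝ;ℂ) and let λ ∈ ℂ satisfy Im(λ²) ≥ 0. Define s₂(λ) = −λ²·I_λ({x₁<y₁}), s₄(λ) = λ⁴·I_λ({x₁<y₁<x₂<y₂}), and s₆(λ) = −λ⁶·I_λ({x₁<y₁<x₂<y₂<x₃<y₃}). Then b₆(λ) := s₆(λ) − s₂(λ)·s₄(λ) + s₂(λ)³/3 = −4·λ⁶·( I_λ({x₁<x₂<y₁<x₃<y₂<y₃}) + 3·I_λ({x₁<x₂<x₃<y₁<y₂<y₃}) ). -/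
open MeasureTheory

open MeasureTheory Finset

/-- The coordinates of a point of `ℝ⁶`, separated into the `x`-variables and the `y`-variables. -/
def coordEquiv : (ℝ × ℝ × ℝ × ℝ × ℝ × ℝ) ≃ₗ[ℝ] (Fin 3 → ℝ) × (Fin 3 → ℝ) where
  toFun p := (![p.1, p.2.2.1, p.2.2.2.2.1], ![p.2.1, p.2.2.2.1, p.2.2.2.2.2])
  invFun z := (z.1 0, z.2 0, z.1 1, z.2 1, z.1 2, z.2 2)
  map_add' p p' := by ext i <;> fin_cases i <;> rfl
  map_smul' c p := by ext i <;> fin_cases i <;> rfl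
  left_inv p := rfl
  right_inv z := by ext i <;> fin_cases i <;> rfl

lemma coordEquiv_symm_apply (z : (Fin 3 → ℝ) × (Fin 3 → ℝ)) :
    coordEquiv.symm z = (z.1 0, z.2 0, z.1 1, z.2 1, z.1 2, z.2 2) :=
  rfl

lemma coordEquiv_apply (p : ℝ × ℝ × ℝ × ℝ × ℝ × ℝ) :
    coordEquiv p = (![p.1, p.2.2.1, p.2.2.2.2.1], ![p.2.1, p.2.2.2.1, p.2.2.2.2.2]) :=
  rfl

/-- Permutation of the `x`-variables by `g.1` and of the `y`-variables by `g.2`. -/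
def permMap (g : Equiv.Perm (Fin 3) × Equiv.Perm (Fin 3)) :
    (ℝ × ℝ × ℝ × ℝ × ℝ × ℝ) →ₗ[ℝ] (ℝ × ℝ × ℝ × ℝ × ℝ × ℝ) :=
  coordEquiv.symm.toLinearMap ∘ₗ
    (LinearMap.prodMap (LinearMap.funLeft ℝ ℝ g.1) (LinearMap.funLeft ℝ ℝ g.2)) ∘ₗ
      coordEquiv.toLinearMap

lemma permMap_apply (g : Equiv.Perm (Fin 3) × Equiv.Perm (Fin 3))
    (p : ℝ × ℝ × ℝ × ℝ × ℝ × ℝ) :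
    permMap g p = coordEquiv.symm ((coordEquiv p).1 ∘ g.1, (coordEquiv p).2 ∘ g.2) :=
  rfl

lemma coordEquiv_permMap (g : Equiv.Perm (Fin 3) × Equiv.Perm (Fin 3))
    (p : ℝ × ℝ × ℝ × ℝ × ℝ × ℝ) :
    coordEquiv (permMap g p) = ((coordEquiv p).1 ∘ g.1, (coordEquiv p).2 ∘ g.2) := by
  rw [permMap_apply, LinearEquiv.apply_symm_apply]

lemma permMap_pow (g : Equiv.Perm (Fin 3) × Equiv.Perm (Fin 3)) (n : ℕ) :
    permMap g ^ n = permMap (g ^ n) := by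
  induction n with
  | zero => rfl
  | succ n ih =>
    refine LinearMap.ext fun p => coordEquiv.injective ?_
    rw [pow_succ', ih, Module.End.mul_apply, pow_succ]
    simp only [coordEquiv_permMap]
    rfl

instance isAddHaarMeasure_volume_prod {G H : Type*} [NormedAddCommGroup G] [MeasureSpace G]
    [BorelSpace G] [SecondCountableTopology G] [NormedAddCommGroup H] [MeasureSpace H]
    [BorelSpace H] [SecondCountableTopology H] [SFinite (volume : Measure G)]
    [SFinite (volume : Measure H)] [(volume : Measure G).IsAddHaarMeasure]
    [(volume : Measure H).IsAddHaarMeasure] : (volume : Measure (G × H)).IsAddHaarMeasure :=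
  inferInstanceAs ((volume : Measure G).prod (volume : Measure H)).IsAddHaarMeasure

instance isAddHaarMeasure_volume_six :
    (volume : Measure (ℝ × ℝ × ℝ × ℝ × ℝ × ℝ)).IsAddHaarMeasure :=
  have : (volume : Measure (ℝ × ℝ × ℝ)).IsAddHaarMeasure := isAddHaarMeasure_volume_prod
  have : (volume : Measure (ℝ × ℝ × ℝ × ℝ)).IsAddHaarMeasure := isAddHaarMeasure_volume_prod
  have : (volume : Measure (ℝ × ℝ × ℝ × ℝ × ℝ)).IsAddHaarMeasure := isAddHaarMeasure_volume_prod
  isAddHaarMeasure_volume_prod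

/-- A linear endomorphism of finite order preserves Haar measure. -/
lemma measurePreserving_of_pow_eq_one {E : Type*} [NormedAddCommGroup E] [NormedSpace ℝ E]
    [MeasurableSpace E] [BorelSpace E] [FiniteDimensional ℝ E] (μ : Measure E)
    [μ.IsAddHaarMeasure] {f : E →ₗ[ℝ] E} {n : ℕ} (hn : n ≠ 0) (hf : f ^ n = 1) :
    MeasurePreserving f μ μ := by
  have hdet : |LinearMap.det f| = 1 := by
    have h : LinearMap.det f ^ n = 1 := by rw [← map_pow, hf, map_one]
    rw [← pow_eq_one_iff_of_nonneg (abs_nonneg _) hn, ← abs_pow, h, abs_one]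
  refine ⟨f.continuous_of_finiteDimensional.measurable, ?_⟩
  rw [Measure.map_linearMap_addHaar_eq_smul_addHaar μ (by intro h; simp [h] at hdet), abs_inv,
    hdet]
  simp

lemma measurePreserving_permMap (g : Equiv.Perm (Fin 3) × Equiv.Perm (Fin 3)) :
    MeasurePreserving (permMap g) := by
  refine measurePreserving_of_pow_eq_one _
    (Fintype.card_ne_zero (α := Equiv.Perm (Fin 3) × Equiv.Perm (Fin 3)))
    ((permMap_pow g _).trans ?_)
  rw [pow_card_eq_one]
  rfl

/-- A nonzero linear functional is almost everywhere nonzero. -/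
lemma ae_ne_zero_of_apply_ne_zero {E : Type*} [NormedAddCommGroup E] [NormedSpace ℝ E]
    [MeasurableSpace E] [BorelSpace E] [FiniteDimensional ℝ E] (μ : Measure E)
    [μ.IsAddHaarMeasure] (l : E →ₗ[ℝ] ℝ) (v : E) (hv : l v ≠ 0) : ∀ᵐ p ∂μ, l p ≠ 0 := by
  have h := Measure.addHaar_submodule μ (LinearMap.ker l) fun h =>
    hv (LinearMap.mem_ker.1 (h ▸ Submodule.mem_top))
  rw [ae_iff]
  convert h using 2
  ext p
  simp

lemma ae_coord_ne : ∀ᵐ p : ℝ × ℝ × ℝ × ℝ × ℝ × ℝ,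
    Function.Injective (coordEquiv p).1 ∧ Function.Injective (coordEquiv p).2 ∧
      ∀ i j, (coordEquiv p).1 i ≠ (coordEquiv p).2 j := by
  let x (i : Fin 3) : (ℝ × ℝ × ℝ × ℝ × ℝ × ℝ) →ₗ[ℝ] ℝ :=
    LinearMap.proj i ∘ₗ LinearMap.fst ℝ _ _ ∘ₗ coordEquiv.toLinearMap
  let y (i : Fin 3) : (ℝ × ℝ × ℝ × ℝ × ℝ × ℝ) →ₗ[ℝ] ℝ :=
    LinearMap.proj i ∘ₗ LinearMap.snd ℝ _ _ ∘ₗ coordEquiv.toLinearMap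
  have hx : ∀ᵐ p : ℝ × ℝ × ℝ × ℝ × ℝ × ℝ, ∀ i j, i ≠ j → (x i - x j) p ≠ 0 := by
    simp only [ae_all_iff]
    intro i j hij
    refine ae_ne_zero_of_apply_ne_zero _ _ (coordEquiv.symm (Pi.single i 1, 0)) ?_
    simp [x, hij.symm]
  have hy : ∀ᵐ p : ℝ × ℝ × ℝ × ℝ × ℝ × ℝ, ∀ i j, i ≠ j → (y i - y j) p ≠ 0 := by
    simp only [ae_all_iff]
    intro i j hij
    refine ae_ne_zero_of_apply_ne_zero _ _ (coordEquiv.symm (0, Pi.single i 1)) ?_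
    simp [y, hij.symm]
  have hxy : ∀ᵐ p : ℝ × ℝ × ℝ × ℝ × ℝ × ℝ, ∀ i j, (x i - y j) p ≠ 0 := by
    simp only [ae_all_iff]
    intro i j
    refine ae_ne_zero_of_apply_ne_zero _ _ (coordEquiv.symm (Pi.single i 1, 0)) ?_
    simp [x, y]
  filter_upwards [hx, hy, hxy] with p h1 h2 h3
  refine ⟨fun i j h => ?_, fun i j h => ?_, fun i j h => h3 i j (sub_eq_zero.2 h)⟩
  · by_contra hij
    exact h1 i j hij (sub_eq_zero.2 h)
  · by_contra hij
    exact h2 i j hij (sub_eq_zero.2 h)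

/-- The region `{x₁ < y₁, x₂ < y₂}` of `ℝ⁴`. -/
def regionPairPair : Set (ℝ × ℝ × ℝ × ℝ) := {p | (p.1, p.2.1) ∈ R_XY ∧ p.2.2 ∈ R_XY}

/-- The region `{x₁ < y₁, x₂ < y₂ < x₃ < y₃}` of `ℝ⁶`. -/
def regionPairChain : Set (ℝ × ℝ × ℝ × ℝ × ℝ × ℝ) :=
  {p | (p.1, p.2.1) ∈ R_XY ∧ p.2.2 ∈ R_XYXY}

/-- The region `{x₁ < y₁, x₂ < y₂, x₃ < y₃}` of `ℝ⁶`. -/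
def regionTriple : Set (ℝ × ℝ × ℝ × ℝ × ℝ × ℝ) :=
  {p | (p.1, p.2.1) ∈ R_XY ∧ p.2.2 ∈ regionPairPair}

/-- A product of two set integrals, as one set integral over a right-associated product. -/
lemma setIntegral_mul_setIntegral {A : Set (ℝ × ℝ)} {α : Type*} [MeasureSpace α]
    [SFinite (volume : Measure α)] {B : Set α} (u : ℝ × ℝ → ℂ) (v : α → ℂ) :
    (∫ p in A, u p) * (∫ p in B, v p) =
      ∫ p in {p : ℝ × ℝ × α | (p.1, p.2.1) ∈ A ∧ p.2.2 ∈ B}, u (p.1, p.2.1) * v p.2.2 := by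
  rw [← setIntegral_prod_mul]
  exact ((volume_preserving_prodAssoc (α₁ := ℝ) (β₁ := ℝ) (γ₁ := α)).setIntegral_preimage_emb
    MeasurableEquiv.prodAssoc.measurableEmbedding
    (fun p : ℝ × ℝ × α => u (p.1, p.2.1) * v p.2.2)
    {p : ℝ × ℝ × α | (p.1, p.2.1) ∈ A ∧ p.2.2 ∈ B})

lemma f2_mul_f4 (q : ℝ → ℂ) (lam : ℂ) :
    (∫ p in R_XY, f2 q lam p) * (∫ p in R_XYXY, f4 q lam p) =
      ∫ p in regionPairChain, f6 q lam p := by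
  rw [setIntegral_mul_setIntegral]
  simp only [f2, f4, f6, ← mul_assoc]
  rfl

lemma f2_cube (q : ℝ → ℂ) (lam : ℂ) :
    (∫ p in R_XY, f2 q lam p) ^ 3 = ∫ p in regionTriple, f6 q lam p := by
  rw [pow_succ', sq, setIntegral_mul_setIntegral, setIntegral_mul_setIntegral]
  simp only [f2, f6, ← mul_assoc]
  rfl

/-- The half-space `Σ x ≤ Σ y`, on which the exponential factor of `f6` is bounded. -/
def halfSpace : Set (ℝ × ℝ × ℝ × ℝ × ℝ × ℝ) :=
  {p | ∑ i, (coordEquiv p).1 i ≤ ∑ i, (coordEquiv p).2 i}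

lemma f6_eq_prod (q : ℝ → ℂ) (lam : ℂ) (p : ℝ × ℝ × ℝ × ℝ × ℝ × ℝ) :
    f6 q lam p = (∏ i, q ((coordEquiv p).2 i)) *
      (∏ i, (starRingEnd ℂ) (q ((coordEquiv p).1 i))) *
      Complex.exp (2 * Complex.I * lam ^ 2 *
        ((∑ i, (coordEquiv p).2 i - ∑ i, (coordEquiv p).1 i : ℝ) : ℂ)) := by
  have h : 2 * Complex.I * lam ^ 2 *
        ((∑ i, (coordEquiv p).2 i - ∑ i, (coordEquiv p).1 i : ℝ) : ℂ) =
      2 * Complex.I * lam ^ 2 * ((p.2.1 - p.1 : ℝ) : ℂ) +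
      2 * Complex.I * lam ^ 2 * ((p.2.2.2.1 - p.2.2.1 : ℝ) : ℂ) +
      2 * Complex.I * lam ^ 2 * ((p.2.2.2.2.2 - p.2.2.2.2.1 : ℝ) : ℂ) := by
    simp [coordEquiv_apply, Fin.sum_univ_succ]
    ring
  rw [h, Complex.exp_add, Complex.exp_add]
  simp [f6, ker, coordEquiv_apply, Fin.prod_univ_succ]
  ring

/-- The integrand `f6`, cut off outside the half-space `Σ x ≤ Σ y`. -/
noncomputable def cutoff (q : ℝ → ℂ) (lam : ℂ) : (ℝ × ℝ × ℝ × ℝ × ℝ × ℝ) → ℂ :=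
  halfSpace.indicator (f6 q lam)

lemma cutoff_permMap (q : ℝ → ℂ) (lam : ℂ) (g : Equiv.Perm (Fin 3) × Equiv.Perm (Fin 3))
    (p : ℝ × ℝ × ℝ × ℝ × ℝ × ℝ) : cutoff q lam (permMap g p) = cutoff q lam p := by
  have h1 := Equiv.sum_comp g.1 (coordEquiv p).1
  have h2 := Equiv.sum_comp g.2 (coordEquiv p).2
  have h3 := Equiv.prod_comp g.1 fun i => (starRingEnd ℂ) (q ((coordEquiv p).1 i))
  have h4 := Equiv.prod_comp g.2 fun i => q ((coordEquiv p).2 i)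
  simp only [cutoff, Set.indicator, halfSpace, Set.mem_ofPred_eq, f6_eq_prod, coordEquiv_permMap,
    Function.comp_apply, h1, h2, h3, h4]

lemma continuous_f6 (q : SchwartzMap ℝ ℂ) (lam : ℂ) : Continuous (f6 q lam) := by
  have := q.continuous
  unfold f6 ker
  fun_prop

lemma measurableSet_halfSpace : MeasurableSet halfSpace := by
  simp only [halfSpace, coordEquiv_apply, Fin.sum_univ_succ]
  apply measurableSet_le <;> simp <;> fun_prop

lemma norm_cutoff_le (q : ℝ → ℂ) {lam : ℂ} (hlam : 0 ≤ (lam ^ 2).im)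
    (p : ℝ × ℝ × ℝ × ℝ × ℝ × ℝ) : ‖cutoff q lam p‖ ≤
      ‖q p.1‖ * (‖q p.2.1‖ * (‖q p.2.2.1‖ * (‖q p.2.2.2.1‖ *
        (‖q p.2.2.2.2.1‖ * ‖q p.2.2.2.2.2‖)))) := by
  by_cases hp : p ∈ halfSpace
  · rw [cutoff, Set.indicator_of_mem hp, f6_eq_prod, norm_mul]
    refine (mul_le_of_le_one_right (norm_nonneg _) ?_).trans_eq ?_
    · rw [Complex.norm_exp, Real.exp_le_one_iff, mul_assoc, mul_assoc, Complex.mul_re]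
      have h : 0 ≤ ∑ i, (coordEquiv p).2 i - ∑ i, (coordEquiv p).1 i := sub_nonneg.2 hp
      have := mul_nonneg hlam h
      simp only [Complex.mul_re, Complex.mul_im, Complex.I_re, Complex.I_im, Complex.re_ofNat,
        Complex.im_ofNat, Complex.ofReal_re, Complex.ofReal_im]
      linarith
    · simp [coordEquiv_apply, Fin.prod_univ_succ]
      ring
  · rw [cutoff, Set.indicator_of_notMem hp, norm_zero]
    positivity

lemma integrable_cutoff (q : SchwartzMap ℝ ℂ) {lam : ℂ} (hlam : 0 ≤ (lam ^ 2).im) :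
    Integrable (cutoff q lam) := by
  have hq : Integrable fun x => ‖q x‖ := q.integrable.norm
  refine Integrable.mono' (hq.mul_prod (hq.mul_prod (hq.mul_prod (hq.mul_prod
    (hq.mul_prod hq))))) ?_ (.of_forall (norm_cutoff_le q hlam))
  exact (continuous_f6 q lam).aestronglyMeasurable.indicator measurableSet_halfSpace

/-- A set integral of `f6` over a subset of the half-space, in terms of the cut-off integrand. -/
lemma setIntegral_f6 (q : ℝ → ℂ) (lam : ℂ) {A : Set (ℝ × ℝ × ℝ × ℝ × ℝ × ℝ)}
    (hA : MeasurableSet A) (h : A ⊆ halfSpace) :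
    ∫ p in A, f6 q lam p = ∫ p, A.indicator 1 p * cutoff q lam p := by
  rw [← integral_indicator hA]
  congr 1 with p
  by_cases hp : p ∈ A
  · simp [cutoff, hp, h hp]
  · simp [hp]

/-- Weights which vanish after symmetrization integrate to zero against the cut-off integrand. -/
lemma integral_mul_cutoff_eq_zero {q : ℝ → ℂ} {lam : ℂ} {w : (ℝ × ℝ × ℝ × ℝ × ℝ × ℝ) → ℂ}
    (hw : Integrable fun p => w p * cutoff q lam p)
    (h0 : ∀ᵐ p, ∑ g, w (permMap g p) = 0) :
    ∫ p, w p * cutoff q lam p = 0 := by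
  have hinj (g) : Function.Injective (permMap g) := fun p p' h => by
    have h' := congrArg coordEquiv h
    simp only [coordEquiv_permMap, Prod.mk.injEq] at h'
    exact coordEquiv.injective (Prod.ext (g.1.surjective.injective_comp_right h'.1)
      (g.2.surjective.injective_comp_right h'.2))
  have hemb (g) : MeasurableEmbedding (permMap g) :=
    (permMap g).continuous_of_finiteDimensional.measurableEmbedding (hinj g)
  have hI (g) : ∫ p, w (permMap g p) * cutoff q lam p = ∫ p, w p * cutoff q lam p := by
    have h := (measurePreserving_permMap g).integral_comp (hemb g) fun p => w p * cutoff q lam p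
    simpa only [cutoff_permMap] using h
  have hint (g) : Integrable fun p => w (permMap g p) * cutoff q lam p := by
    have := (measurePreserving_permMap g).integrable_comp_of_integrable hw
    simpa only [Function.comp_def, cutoff_permMap] using this
  have hsum : ∑ g, ∫ p, w (permMap g p) * cutoff q lam p = 0 := by
    rw [← integral_finsetSum _ fun g _ => hint g]
    refine integral_eq_zero_of_ae ?_
    filter_upwards [h0] with p hp
    rw [← Finset.sum_mul, hp, zero_mul, Pi.zero_apply]
  simpa [hI] using hsum

/-- The combination of indicators of the regions appearing in `b₆`. -/
noncomputable def weight (p : ℝ × ℝ × ℝ × ℝ × ℝ × ℝ) : ℂ :=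
  R_XYXYXY.indicator 1 p - regionPairChain.indicator 1 p + regionTriple.indicator 1 p / 3
    - 4 * (R_XXYXYY.indicator 1 p + 3 * R_XXXYYY.indicator 1 p)

lemma measurableSet_R_XYXYXY : MeasurableSet R_XYXYXY := by
  unfold R_XYXYXY
  measurability

lemma measurableSet_regionPairChain : MeasurableSet regionPairChain := by
  unfold regionPairChain R_XY R_XYXY
  dsimp
  measurability

lemma measurableSet_regionTriple : MeasurableSet regionTriple := by
  unfold regionTriple regionPairPair R_XY
  dsimp
  measurability

lemma measurableSet_R_XXYXYY : MeasurableSet R_XXYXYY := by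
  unfold R_XXYXYY
  measurability

lemma measurableSet_R_XXXYYY : MeasurableSet R_XXXYYY := by
  unfold R_XXXYYY
  measurability

lemma R_XYXYXY_subset_halfSpace : R_XYXYXY ⊆ halfSpace := by
  rintro p ⟨_, _, _, _, _⟩
  simp [halfSpace, coordEquiv_apply, Fin.sum_univ_succ]
  linarith

lemma regionPairChain_subset_halfSpace : regionPairChain ⊆ halfSpace := by
  rintro p ⟨h, _, _, _⟩
  simp only [R_XY, Set.mem_ofPred_eq] at h
  simp [halfSpace, coordEquiv_apply, Fin.sum_univ_succ]
  linarith

lemma regionTriple_subset_halfSpace : regionTriple ⊆ halfSpace := by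
  rintro p ⟨h, h', h''⟩
  simp only [R_XY, Set.mem_ofPred_eq] at h h' h''
  simp [halfSpace, coordEquiv_apply, Fin.sum_univ_succ]
  linarith

lemma R_XXYXYY_subset_halfSpace : R_XXYXYY ⊆ halfSpace := by
  rintro p ⟨_, _, _, _, _⟩
  simp [halfSpace, coordEquiv_apply, Fin.sum_univ_succ]
  linarith

lemma R_XXXYYY_subset_halfSpace : R_XXXYYY ⊆ halfSpace := by
  rintro p ⟨_, _, _, _, _⟩
  simp [halfSpace, coordEquiv_apply, Fin.sum_univ_succ]
  linarith

lemma univ_perm_fin_three : (univ : Finset (Equiv.Perm (Fin 3))) =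
    {1, Equiv.swap 0 1, Equiv.swap 1 2, Equiv.swap 0 2, Equiv.swap 0 1 * Equiv.swap 1 2,
      Equiv.swap 1 2 * Equiv.swap 0 1} := by
  decide

lemma sum_perm_fin_three {M : Type*} [AddCommMonoid M] (F : (Fin 3 → Fin 3) → M) :
    ∑ σ : Equiv.Perm (Fin 3), F σ =
      F ![0, 1, 2] + (F ![1, 0, 2] + (F ![0, 2, 1] + (F ![2, 1, 0] + (F ![1, 2, 0] +
        F ![2, 0, 1])))) := by
  rw [univ_perm_fin_three]
  repeat rw [sum_insert (by decide)]
  rw [sum_singleton]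
  congr! <;> decide

set_option maxHeartbeats 1000000 in
lemma sum_weight_of_strictMono {x y : Fin 3 → ℝ} (hx : StrictMono x) (hy : StrictMono y)
    (hxy : ∀ i j, x i ≠ y j) :
    ∑ σ : Equiv.Perm (Fin 3), ∑ τ : Equiv.Perm (Fin 3),
      weight (coordEquiv.symm (x ∘ σ, y ∘ τ)) = 0 := by
  have a1 : x 0 < x 1 := hx (by decide)
  have a2 : x 1 < x 2 := hx (by decide)
  have a3 : x 0 < x 2 := hx (by decide)
  have b1 : y 0 < y 1 := hy (by decide)
  have b2 : y 1 < y 2 := hy (by decide)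
  have b3 : y 0 < y 2 := hy (by decide)
  rw [sum_perm_fin_three fun s => ∑ τ : Equiv.Perm (Fin 3), weight (coordEquiv.symm (x ∘ s, y ∘ τ))]
  simp only [fun s => sum_perm_fin_three fun t => weight (coordEquiv.symm (x ∘ s, y ∘ t))]
  simp only [weight, Set.indicator, R_XYXYXY, regionPairChain, regionTriple, regionPairPair, R_XY,
    R_XYXY, R_XXYXYY, R_XXXYYY, Set.mem_ofPred_eq, Pi.one_apply, coordEquiv_symm_apply,
    Function.comp_apply, Matrix.cons_val]
  have h00 := lt_or_gt_of_ne (hxy 0 0)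
  have h01 := lt_or_gt_of_ne (hxy 0 1)
  have h02 := lt_or_gt_of_ne (hxy 0 2)
  have h10 := lt_or_gt_of_ne (hxy 1 0)
  have h11 := lt_or_gt_of_ne (hxy 1 1)
  have h12 := lt_or_gt_of_ne (hxy 1 2)
  have h20 := lt_or_gt_of_ne (hxy 2 0)
  have h21 := lt_or_gt_of_ne (hxy 2 1)
  have h22 := lt_or_gt_of_ne (hxy 2 2)
  clear hx hy hxy
  rcases h00 with h00 | h00 <;> rcases h01 with h01 | h01 <;> try (exfalso; linarith)
  all_goals rcases h02 with h02 | h02 <;> try (exfalso; linarith)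
  all_goals rcases h10 with h10 | h10 <;> try (exfalso; linarith)
  all_goals rcases h11 with h11 | h11 <;> try (exfalso; linarith)
  all_goals rcases h12 with h12 | h12 <;> try (exfalso; linarith)
  all_goals rcases h20 with h20 | h20 <;> try (exfalso; linarith)
  all_goals rcases h21 with h21 | h21 <;> try (exfalso; linarith)
  all_goals rcases h22 with h22 | h22 <;> try (exfalso; linarith)
  all_goals
    simp only [a1, a2, a3, b1, b2, b3, h00, h01, h02, h10, h11, h12, h20, h21, h22,
      a1.not_gt, a2.not_gt, a3.not_gt, b1.not_gt, b2.not_gt, b3.not_gt, h00.not_gt, h01.not_gt,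
      h02.not_gt, h10.not_gt, h11.not_gt, h12.not_gt, h20.not_gt, h21.not_gt, h22.not_gt,
      and_true, and_false, if_true, if_false]
    norm_num

lemma exists_perm_strictMono {n : ℕ} {x : Fin n → ℝ} (hx : Function.Injective x) :
    ∃ σ : Equiv.Perm (Fin n), StrictMono (x ∘ σ) :=
  ⟨Tuple.sort x, (Tuple.monotone_sort x).strictMono_of_injective
    (hx.comp (Tuple.sort x).injective)⟩

lemma sum_weight {x y : Fin 3 → ℝ} (hx : Function.Injective x) (hy : Function.Injective y)
    (hxy : ∀ i j, x i ≠ y j) :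
    ∑ σ : Equiv.Perm (Fin 3), ∑ τ : Equiv.Perm (Fin 3),
      weight (coordEquiv.symm (x ∘ σ, y ∘ τ)) = 0 := by
  obtain ⟨s, hs⟩ := exists_perm_strictMono hx
  obtain ⟨t, ht⟩ := exists_perm_strictMono hy
  rw [← sum_weight_of_strictMono hs ht fun i j => hxy (s i) (t j),
    ← Equiv.sum_comp (Equiv.mulLeft s)]
  refine sum_congr rfl fun σ _ => ?_
  rw [← Equiv.sum_comp (Equiv.mulLeft t)]
  rfl

/-- With `s₂(λ) = −λ²·I_λ({x₁<y₁})`, `s₄(λ) = λ⁴·I_λ({x₁<y₁<x₂<y₂})` and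
`s₆(λ) = −λ⁶·I_λ({x₁<y₁<x₂<y₂<x₃<y₃})`, the third logarithmic coefficient
`b₆(λ) = s₆ − s₂s₄ + s₂³/3` equals the combination of connected iterated integrals
`−4λ⁶(I_λ({x₁<x₂<y₁<x₃<y₂<y₃}) + 3·I_λ({x₁<x₂<x₃<y₁<y₂<y₃}))`, for Schwartz `q` and
`Im(λ²) ≥ 0`. -/
theorem b6_connected (q : SchwartzMap ℝ ℂ) (lam : ℂ) (hlam : 0 ≤ (lam ^ 2).im) :
    (-lam ^ 6 * ∫ p in R_XYXYXY, f6 ⇑q lam p)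
      - (-lam ^ 2 * ∫ p in R_XY, f2 ⇑q lam p) * (lam ^ 4 * ∫ p in R_XYXY, f4 ⇑q lam p)
      + (-lam ^ 2 * ∫ p in R_XY, f2 ⇑q lam p) ^ 3 / 3
      = -4 * lam ^ 6 *
          ((∫ p in R_XXYXYY, f6 ⇑q lam p) + 3 * ∫ p in R_XXXYYY, f6 ⇑q lam p) := by
  have i {A : Set (ℝ × ℝ × ℝ × ℝ × ℝ × ℝ)} (hA : MeasurableSet A) :
      Integrable fun p => A.indicator 1 p * cutoff q lam p := by
    have h := (integrable_cutoff q hlam).indicator hA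
    refine h.congr (.of_forall fun p => ?_)
    by_cases hp : p ∈ A <;> simp [hp]
  have hw (p) : weight p * cutoff q lam p =
      R_XYXYXY.indicator 1 p * cutoff q lam p - regionPairChain.indicator 1 p * cutoff q lam p
      + regionTriple.indicator 1 p * cutoff q lam p / 3
      - 4 * (R_XXYXYY.indicator 1 p * cutoff q lam p
        + 3 * (R_XXXYYY.indicator 1 p * cutoff q lam p)) := by
    rw [weight]
    ring
  have i1 := i measurableSet_R_XYXYXY
  have i2 := i measurableSet_regionPairChain
  have i3 := i measurableSet_regionTriple
  have i4 := i measurableSet_R_XXYXYY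
  have i5 := i measurableSet_R_XXXYYY
  have i12 := i1.sub i2
  have i123 := i12.add (i3.div_const 3)
  have i45 := (i4.add (i5.const_mul 3)).const_mul 4
  have key : ∫ p, weight p * cutoff q lam p = 0 := by
    refine integral_mul_cutoff_eq_zero ?_ ?_
    · simp only [hw]
      exact i123.sub i45
    · filter_upwards [ae_coord_ne] with p hp
      simp only [Fintype.sum_prod_type, permMap_apply]
      exact sum_weight hp.1 hp.2.1 hp.2.2
  have key' : (∫ p in R_XYXYXY, f6 q lam p) - (∫ p in regionPairChain, f6 q lam p)
      + (∫ p in regionTriple, f6 q lam p) / 3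
      - 4 * ((∫ p in R_XXYXYY, f6 q lam p) + 3 * ∫ p in R_XXXYYY, f6 q lam p) = 0 := by
    rw [← key, funext hw,
      setIntegral_f6 _ _ measurableSet_R_XYXYXY R_XYXYXY_subset_halfSpace,
      setIntegral_f6 _ _ measurableSet_regionPairChain regionPairChain_subset_halfSpace,
      setIntegral_f6 _ _ measurableSet_regionTriple regionTriple_subset_halfSpace,
      setIntegral_f6 _ _ measurableSet_R_XXYXYY R_XXYXYY_subset_halfSpace,
      setIntegral_f6 _ _ measurableSet_R_XXXYYY R_XXXYYY_subset_halfSpace]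
    refine ((integral_sub i123 i45).trans (congrArg₂ _ ?_ ?_)).symm
    · exact (integral_add i12 (i3.div_const 3)).trans
        (congrArg₂ _ (integral_sub i1 i2) (integral_div _ _))
    · refine (integral_const_mul _ _).trans (congrArg _ ?_)
      exact (integral_add i4 (i5.const_mul 3)).trans (congrArg _ (integral_const_mul _ _))
  rw [← f2_mul_f4, ← f2_cube] at key'
  linear_combination (-lam ^ 6) * key'
end

section
/- Let q belong to the Schwartz space 𝒮(ℝ;ℂ) and let λ ∈ ℂ satisfy Im(λ²) > 0. Then s₂(λ) := −λ² ∫_{x<y} q(y)·conj(q(x))·e^{2iλ²(y−x)} dx dy = −i ∫_ℝ (λ² / (2λ² + ξ)) · |q̂(ξ)|² dξ, where the right-hand integrand is well defined since Im(2λ² + ξ) = 2·Im(λ²) > 0 for all real ξ. -/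
open MeasureTheory

/-- The unitary Fourier transform `q̂(ξ) = (2π)^{−1/2} ∫ q(x) e^{−ixξ} dx`. -/
noncomputable def ft (q : ℝ → ℂ) (ξ : ℝ) : ℂ :=
  ((Real.sqrt (2 * Real.pi) : ℝ) : ℂ)⁻¹ * ∫ x : ℝ, q x * Complex.exp (-Complex.I * x * ξ)

open scoped FourierTransform

/-- The unitary Fourier transform in terms of Mathlib's. -/
theorem ft_eq_fourier (q : ℝ → ℂ) (ξ : ℝ) :
    ft q ξ = ((Real.sqrt (2 * Real.pi) : ℝ) : ℂ)⁻¹ * 𝓕 q (ξ / (2 * Real.pi)) := by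
  rw [ft, Real.fourier_real_eq_integral_exp_smul]
  congr 2
  ext x
  rw [smul_eq_mul, mul_comm]
  congr 2
  push_cast
  field_simp

/-- The autocorrelation of a Schwartz function is the inverse Fourier transform of the
squared modulus of its Fourier transform. -/
theorem SchwartzMap.integral_conj_mul_comp_add (q : SchwartzMap ℝ ℂ) (t : ℝ) :
    ∫ x : ℝ, (starRingEnd ℂ) (q x) * q (x + t)
      = ∫ w : ℝ, Complex.exp (2 * Real.pi * Complex.I * w * t) * ((‖𝓕 (⇑q) w‖ : ℝ) : ℂ) ^ 2 := by
  have h := SchwartzMap.integral_inner_fourier_fourier q (SchwartzMap.compSubConstCLM ℂ (-t) q)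
  have e : ∀ w, 𝓕 (SchwartzMap.compSubConstCLM ℂ (-t) q) w
      = Complex.exp (2 * Real.pi * Complex.I * w * t) * 𝓕 (⇑q) w := by
    intro w
    rw [SchwartzMap.fourier_coe]
    have h2 := congrFun (VectorFourier.fourierIntegral_comp_add_right Real.fourierChar volume
      (innerₗ ℝ) ⇑q t) w
    have h3 : (⇑(SchwartzMap.compSubConstCLM ℂ (-t) q) : ℝ → ℂ) = ⇑q ∘ fun v => v + t := by
      ext v
      simp
    rw [h3]
    refine h2.trans ?_
    rw [Circle.smul_def, Real.fourierChar_apply, smul_eq_mul]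
    congr 2
    simp
    ring
  simp only [e, RCLike.inner_apply, SchwartzMap.compSubConstCLM_apply, sub_neg_eq_add,
    SchwartzMap.fourier_coe] at h
  calc _ = ∫ x : ℝ, q (x + t) * (starRingEnd ℂ) (q x) := by simp_rw [mul_comm]
    _ = _ := h.symm
    _ = _ := by
      congr 1
      ext w
      rw [mul_assoc, Complex.mul_conj']

theorem setIntegral_f2_eq (q : SchwartzMap ℝ ℂ) (lam : ℂ) (hlam : 0 < (lam ^ 2).im) :
    ∫ p in R_XY, f2 ⇑q lam p
      = ∫ t : ℝ in Set.Ioi 0, Complex.exp (2 * Complex.I * lam ^ 2 * t) *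
          ∫ x : ℝ, (starRingEnd ℂ) (q x) * q (x + t) := by
  have hre : (2 * Complex.I * lam ^ 2).re < 0 := by
    simp [Complex.mul_re, Complex.mul_im] at hlam ⊢
    linarith
  have hmp := measurePreserving_prod_add (volume : Measure ℝ) (volume : Measure ℝ)
  have hemb : MeasurableEmbedding (fun z : ℝ × ℝ => (z.1, z.1 + z.2)) :=
    (MeasurableEquiv.shearAddRight ℝ).measurableEmbedding
  have hpre : (fun z : ℝ × ℝ => (z.1, z.1 + z.2)) ⁻¹' R_XY = Set.univ ×ˢ Set.Ioi 0 := by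
    ext z
    simp [R_XY]
  have h1 := hmp.setIntegral_preimage_emb hemb (f2 ⇑q lam) R_XY
  rw [← Measure.volume_eq_prod] at h1
  rw [← h1, hpre, Measure.volume_eq_prod, ← Measure.prod_restrict, Measure.restrict_univ]
  have hf : ∀ z : ℝ × ℝ, f2 ⇑q lam (z.1, z.1 + z.2) = q (z.1 + z.2) *
      ((starRingEnd ℂ) (q z.1) * Complex.exp (2 * Complex.I * lam ^ 2 * z.2)) := by
    intro z
    simp [f2, ker, mul_assoc]
  simp_rw [hf]
  rw [integral_prod_symm]
  · congr 1
    ext t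
    rw [← integral_const_mul]
    congr 1
    ext x
    ring
  · have hq : Integrable (fun x => (starRingEnd ℂ) (q x)) :=
      (Complex.conjCLE : ℂ →L[ℝ] ℂ).integrable_comp (q.integrable (μ := volume))
    refine (hq.mul_prod (integrableOn_exp_mul_complex_Ioi hre 0)).bdd_mul
      (c := SchwartzMap.seminorm ℝ 0 0 q) ?_ ?_
    · exact (q.continuous.comp (by fun_prop)).aestronglyMeasurable
    · exact Filter.Eventually.of_forall fun z => q.norm_le_seminorm ℝ _

theorem setIntegral_exp_mul_integral_fourier (q : SchwartzMap ℝ ℂ) (a : ℂ) (ha : a.re < 0) :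
    ∫ t : ℝ in Set.Ioi 0, Complex.exp (a * t) *
        ∫ w : ℝ, Complex.exp (2 * Real.pi * Complex.I * w * t) * ((‖𝓕 (⇑q) w‖ : ℝ) : ℂ) ^ 2
      = ∫ w : ℝ, -1 / (a + 2 * Real.pi * Complex.I * w) * ((‖𝓕 (⇑q) w‖ : ℝ) : ℂ) ^ 2 := by
  simp_rw [← integral_const_mul]
  rw [integral_integral_swap]
  · congr 1
    ext w
    have hre : (a + 2 * Real.pi * Complex.I * w).re < 0 := by simpa using ha
    have h := integral_exp_mul_complex_Ioi hre 0
    rw [Complex.ofReal_zero, mul_zero, Complex.exp_zero] at h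
    rw [← h, ← integral_mul_const]
    congr 1
    ext t
    rw [add_mul, Complex.exp_add]
    ring
  · have hq : Integrable (fun w => ((‖𝓕 (⇑q) w‖ : ℝ) : ℂ) ^ 2) := by
      have h2 := ((𝓕 q).memLp 2).integrable_norm_pow (by norm_num)
      simp only [SchwartzMap.fourier_coe] at h2
      simpa using h2.ofReal (𝕜 := ℂ)
    have h := ((integrableOn_exp_mul_complex_Ioi ha 0).mul_prod hq).bdd_mul (c := 1)
      (f := fun z : ℝ × ℝ => Complex.exp (2 * Real.pi * Complex.I * z.2 * z.1))
      (by exact (by fun_prop : Continuous _).aestronglyMeasurable)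
      (Filter.Eventually.of_forall fun z => by simp [Complex.norm_exp])
    refine h.congr (Filter.Eventually.of_forall fun z => ?_)
    simp only [Function.uncurry]
    ring

/-- For Schwartz `q` and `Im(λ²) > 0`, the first iterated integral
`s₂(λ) = −λ² ∫_{x<y} q(y) conj(q(x)) e^{2iλ²(y−x)} dx dy` has the Fourier representation
`s₂(λ) = −i ∫ λ²/(2λ²+ξ) |q̂(ξ)|² dξ`. -/
theorem s2_fourier (q : SchwartzMap ℝ ℂ) (lam : ℂ) (hlam : 0 < (lam ^ 2).im) :
    -lam ^ 2 * ∫ p in R_XY, f2 ⇑q lam p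
      = -Complex.I *
          ∫ ξ : ℝ, lam ^ 2 / (2 * lam ^ 2 + (ξ : ℂ)) * ((‖ft ⇑q ξ‖ : ℝ) : ℂ) ^ 2 := by
  have hre : (2 * Complex.I * lam ^ 2).re < 0 := by
    simp [Complex.mul_re, Complex.mul_im] at hlam ⊢
    linarith
  rw [setIntegral_f2_eq q lam hlam]
  simp_rw [q.integral_conj_mul_comp_add]
  rw [setIntegral_exp_mul_integral_fourier q _ hre]
  have hsc := Measure.integral_comp_div (fun w : ℝ =>
    lam ^ 2 / (2 * lam ^ 2 + ((2 * Real.pi * w : ℝ) : ℂ)) *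
      (((2 * Real.pi : ℝ) : ℂ)⁻¹ * ((‖𝓕 (⇑q) w‖ : ℝ) : ℂ) ^ 2)) (2 * Real.pi)
  have hft : ∀ ξ : ℝ, ((‖ft ⇑q ξ‖ : ℝ) : ℂ) ^ 2 =
      ((2 * Real.pi : ℝ) : ℂ)⁻¹ * ((‖𝓕 (⇑q) (ξ / (2 * Real.pi))‖ : ℝ) : ℂ) ^ 2 := by
    intro ξ
    rw [ft_eq_fourier, norm_mul, norm_inv, Complex.norm_real, Real.norm_eq_abs, abs_of_nonneg
      (Real.sqrt_nonneg _), Complex.ofReal_mul, mul_pow, ← Complex.ofReal_pow, inv_pow,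
      Real.sq_sqrt (by positivity), Complex.ofReal_inv]
  have hξ : ∀ ξ : ℝ, 2 * Real.pi * (ξ / (2 * Real.pi)) = ξ := fun ξ => by
    field_simp
  simp_rw [hξ] at hsc
  simp_rw [hft]
  rw [hsc, abs_of_pos (by positivity), Complex.real_smul, ← integral_const_mul,
    ← integral_const_mul, ← integral_const_mul]
  congr 1
  ext w
  have hd : 2 * Complex.I * lam ^ 2 + 2 * Real.pi * Complex.I * w
      = Complex.I * (2 * lam ^ 2 + 2 * Real.pi * w) := by ring
  rw [hd]
  push_cast
  field_simp
  simp [neg_div]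
end

section
/- Let q belong to the Schwartz space 𝒮(ℝ;ℂ). Then lim_{τ→+∞} ( −iτ ∫_{x<y} q(y)·conj(q(x))·e^{−2τ(y−x)} dx dy ) = −(i/2)·‖q‖²_{L²(ℝ)}. Equivalently, along the ray λ² = iτ with τ → +∞, the first iterated integral s₂(λ) = −λ² ∫_{x<y} q(y)·conj(q(x))·e^{2iλ²(y−x)} dx dy converges to −(i/2)·‖q‖²_{L²(ℝ)}. -/
open MeasureTheory

/-- The scaled one-sided Laplace average of `q` at `x`, after the substitution `s = τ t`. -/
lemma mul_setIntegral_exp_scale (q : ℝ → ℂ) (x : ℝ) {τ : ℝ} (hτ : 0 < τ) :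
    (τ : ℂ) * ∫ t in Set.Ioi (0 : ℝ), q (x + t) * Complex.exp ((-2 * τ * t : ℝ) : ℂ) =
      ∫ s in Set.Ioi (0 : ℝ), q (x + τ⁻¹ * s) * Complex.exp ((-2 * s : ℝ) : ℂ) := by
  have h := integral_comp_mul_left_Ioi
    (fun t : ℝ => q (x + t) * Complex.exp ((-2 * τ * t : ℝ) : ℂ)) 0 (inv_pos.mpr hτ)
  rw [mul_zero, inv_inv, Complex.real_smul] at h
  rw [← h]
  refine integral_congr_ae (Filter.Eventually.of_forall fun s => ?_)
  have : -2 * τ * (τ⁻¹ * s) = -2 * s := by field_simp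
  simp only [this]

lemma integrableOn_exp_neg_two_mul {τ : ℝ} (hτ : 0 < τ) :
    IntegrableOn (fun t : ℝ => Real.exp (-2 * τ * t)) (Set.Ioi 0) :=
  integrableOn_exp_mul_Ioi (by linarith) 0

lemma SchwartzMap.exists_norm_le (q : SchwartzMap ℝ ℂ) : ∃ C, ∀ x, ‖q x‖ ≤ C :=
  ⟨_, fun x => q.norm_le_seminorm ℝ x⟩

lemma integrableOn_shear (q : SchwartzMap ℝ ℂ) {τ : ℝ} (hτ : 0 < τ) :
    IntegrableOn (fun p : ℝ × ℝ => q (p.1 + p.2) * (starRingEnd ℂ) (q p.1) *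
      Complex.exp ((-2 * τ * p.2 : ℝ) : ℂ)) (Set.univ ×ˢ Set.Ioi 0)
      ((volume : Measure ℝ).prod volume) := by
  obtain ⟨C, hC⟩ := q.exists_norm_le
  have hq := q.continuous
  rw [IntegrableOn, ← Measure.prod_restrict, Measure.restrict_univ]
  have hb := (q.integrable (μ := volume)).norm.mul_prod
    ((integrableOn_exp_neg_two_mul hτ).const_mul C)
  refine hb.mono' (Continuous.aestronglyMeasurable ?_) (Filter.Eventually.of_forall fun p => ?_)
  · have := Complex.continuous_conj
    fun_prop
  · rw [norm_mul, norm_mul, RCLike.norm_conj, Complex.norm_exp_ofReal]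
    calc ‖q (p.1 + p.2)‖ * ‖q p.1‖ * Real.exp (-2 * τ * p.2)
        ≤ C * ‖q p.1‖ * Real.exp (-2 * τ * p.2) := by gcongr; exact hC _
      _ = _ := by ring

lemma setIntegral_lt_eq_shear (f : ℝ × ℝ → ℂ) :
    ∫ p in {p : ℝ × ℝ | p.1 < p.2}, f p =
      ∫ p in Set.univ ×ˢ Set.Ioi (0 : ℝ), f (p.1, p.1 + p.2)
        ∂((volume : Measure ℝ).prod volume) := by
  have h := (measurePreserving_prod_add (volume : Measure ℝ)
    (volume : Measure ℝ)).setIntegral_preimage_emb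
    (MeasurableEquiv.shearAddRight ℝ).measurableEmbedding f {p : ℝ × ℝ | p.1 < p.2}
  rw [Measure.volume_eq_prod, ← h]
  congr 2
  ext p
  simp

lemma tendsto_setIntegral_exp_scale (q : SchwartzMap ℝ ℂ) (x : ℝ) :
    Filter.Tendsto (fun τ : ℝ =>
      ∫ s in Set.Ioi (0 : ℝ), q (x + τ⁻¹ * s) * Complex.exp ((-2 * s : ℝ) : ℂ))
      Filter.atTop (nhds (q x / 2)) := by
  obtain ⟨C, hC⟩ := q.exists_norm_le
  have hq := q.continuous
  have hlim : ∫ s in Set.Ioi (0 : ℝ), q x * Complex.exp ((-2 * s : ℝ) : ℂ) = q x / 2 := by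
    simp_rw [← Complex.ofReal_exp]
    rw [integral_const_mul, integral_complex_ofReal, integral_exp_mul_Ioi (by norm_num)]
    simp
    ring
  rw [← hlim]
  have hb := (integrableOn_exp_neg_two_mul one_pos).const_mul C
  refine tendsto_integral_filter_of_dominated_convergence _
    (Filter.Eventually.of_forall fun τ => Continuous.aestronglyMeasurable (by fun_prop))
    (Filter.Eventually.of_forall fun τ => Filter.Eventually.of_forall fun s => ?_) hb
    (Filter.Eventually.of_forall fun s => ?_)
  · rw [norm_mul, Complex.norm_exp_ofReal, mul_one]
    gcongr
    exact hC _
  · refine Filter.Tendsto.mul_const _ ((hq.tendsto x).comp ?_)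
    simpa using (tendsto_inv_atTop_zero.mul_const s).const_add x

lemma norm_setIntegral_exp_scale_le {q : ℝ → ℂ} {C : ℝ} (hC : ∀ x, ‖q x‖ ≤ C) (x τ : ℝ) :
    ‖∫ s in Set.Ioi (0 : ℝ), q (x + τ⁻¹ * s) * Complex.exp ((-2 * s : ℝ) : ℂ)‖ ≤
      ∫ s in Set.Ioi (0 : ℝ), C * Real.exp (-2 * 1 * s) := by
  refine norm_integral_le_of_norm_le ((integrableOn_exp_neg_two_mul one_pos).const_mul C)
    (Filter.Eventually.of_forall fun s => ?_)
  rw [norm_mul, Complex.norm_exp_ofReal, mul_one]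
  gcongr
  exact hC _

/-- For Schwartz `q`, along the ray `λ² = iτ`, `τ → +∞`, the first iterated integral
`s₂(λ) = −λ² ∫_{x<y} q(y) conj(q(x)) e^{2iλ²(y−x)} dx dy
       = −iτ ∫_{x<y} q(y) conj(q(x)) e^{−2τ(y−x)} dx dy`
converges to `−(i/2)‖q‖²_{L²(ℝ)}`. -/
theorem s2_limit (q : SchwartzMap ℝ ℂ) :
    Filter.Tendsto
      (fun τ : ℝ => -Complex.I * (τ : ℂ) *
        ∫ p in {p : ℝ × ℝ | p.1 < p.2},
          q p.2 * (starRingEnd ℂ) (q p.1) * Complex.exp (((-2 * τ * (p.2 - p.1) : ℝ) : ℂ)))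
      Filter.atTop
      (nhds (-(Complex.I / 2) * ((∫ x : ℝ, ‖q x‖ ^ 2 : ℝ) : ℂ))) := by
  obtain ⟨C, hC⟩ := q.exists_norm_le
  have inner_eq {τ : ℝ} (hτ : 0 < τ) (x : ℝ) :
      (τ : ℂ) * ∫ t in Set.Ioi (0 : ℝ), q (x + t) * (starRingEnd ℂ) (q x) *
        Complex.exp ((-2 * τ * t : ℝ) : ℂ) =
      (starRingEnd ℂ) (q x) *
        ∫ s in Set.Ioi (0 : ℝ), q (x + τ⁻¹ * s) * Complex.exp ((-2 * s : ℝ) : ℂ) := by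
    rw [← mul_setIntegral_exp_scale q x hτ, mul_left_comm, ← integral_const_mul ((starRingEnd ℂ) (q x))]
    congr 2
    ext t
    ring
  have iterated_eq {τ : ℝ} (hτ : 0 < τ) :
      (τ : ℂ) * ∫ p in {p : ℝ × ℝ | p.1 < p.2},
        q p.2 * (starRingEnd ℂ) (q p.1) * Complex.exp (((-2 * τ * (p.2 - p.1) : ℝ) : ℂ)) =
      ∫ x, (starRingEnd ℂ) (q x) *
        ∫ s in Set.Ioi (0 : ℝ), q (x + τ⁻¹ * s) * Complex.exp ((-2 * s : ℝ) : ℂ) := by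
    rw [setIntegral_lt_eq_shear]
    simp only [add_sub_cancel_left]
    rw [setIntegral_prod _ (integrableOn_shear q hτ), Measure.restrict_univ,
      ← integral_const_mul]
    simp only [inner_eq hτ]
  have hmain : Filter.Tendsto (fun τ : ℝ => ∫ x, (starRingEnd ℂ) (q x) *
      ∫ s in Set.Ioi (0 : ℝ), q (x + τ⁻¹ * s) * Complex.exp ((-2 * s : ℝ) : ℂ))
      Filter.atTop (nhds (∫ x, (starRingEnd ℂ) (q x) * (q x / 2))) := by
    refine tendsto_integral_filter_of_dominated_convergence
      (fun x => ‖q x‖ * ∫ s in Set.Ioi (0 : ℝ), C * Real.exp (-2 * 1 * s)) ?_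
      (Filter.Eventually.of_forall fun τ => Filter.Eventually.of_forall fun x => ?_)
      ((q.integrable (μ := volume)).norm.mul_const _)
      (Filter.Eventually.of_forall fun x => (tendsto_setIntegral_exp_scale q x).const_mul _)
    · filter_upwards [Filter.eventually_gt_atTop 0] with τ hτ
      have h := integrableOn_shear q hτ
      rw [IntegrableOn, ← Measure.prod_restrict, Measure.restrict_univ] at h
      simpa only [inner_eq hτ] using (h.integral_prod_left.const_mul (τ : ℂ)).aestronglyMeasurable
    · rw [norm_mul, RCLike.norm_conj]
      gcongr
      exact norm_setIntegral_exp_scale_le hC x τ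
  have hval : -(Complex.I / 2) * ((∫ x : ℝ, ‖q x‖ ^ 2 : ℝ) : ℂ) =
      -Complex.I * ∫ x, (starRingEnd ℂ) (q x) * (q x / 2) := by
    have h (x : ℝ) : (starRingEnd ℂ) (q x) * (q x / 2) = ((‖q x‖ ^ 2 : ℝ) : ℂ) / 2 := by
      rw [← mul_div_assoc, Complex.conj_mul']
      push_cast
      rfl
    simp_rw [h]
    rw [integral_div, integral_complex_ofReal]
    ring
  rw [hval]
  refine (hmain.const_mul (-Complex.I)).congr' ?_
  filter_upwards [Filter.eventually_gt_atTop 0] with τ hτ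
  rw [mul_assoc, iterated_eq hτ]
end
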